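/- Let s ≥ 2 and let P_m be a dyadic digital (t_m, m, s)-net in base 2 with t_m ≤ (1/10)·log₂ m. Then the Levi conditional expectation satisfies E^{(m)}_{Y,T}( ( ∑_{k=1}^m ( E^{(m)}_{Y,T}(𝔇_k² | F_{k−1}) − E^{(m)}_{Y,T}(𝔇_k²) ) )² ) ≪ m^{2(s−1) − 1/5}, where the implied constant depends only on s. -/

import Mathlib

open MeasureTheory Filter

noncomputable section

attribute [local instance] Classical.propDecidable

/-- The `a`-th binary digit (`a ≥ 1`) of the dyadic expansion of `x ∈ [0,1)`
(the finite expansion is used for dyadic rationals). -/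
def bdigit (a : ℕ) (x : ℝ) : ℕ := (⌊x * 2 ^ a⌋).toNat % 2

/-- Digitwise addition modulo 2 of dyadic expansions: `x ⊕ y`. -/
def xorReal (x y : ℝ) : ℝ :=
  ∑' a : ℕ, (((bdigit (a + 1) x + bdigit (a + 1) y) % 2 : ℕ) : ℝ) / 2 ^ (a + 1)

/-- Coordinatewise digitwise addition `⊕` on vectors. -/
def xorVec {s : ℕ} (X Y : Fin s → ℝ) : Fin s → ℝ := fun i => xorReal (X i) (Y i)

/-- Local discrepancy `D(P, Y)` of a finite point set `P` in `[0,1)^s`. -/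
def Dloc {N s : ℕ} (P : Fin N → Fin s → ℝ) (Y : Fin s → ℝ) : ℝ :=
  (∑ n : Fin N, if ∀ i, 0 ≤ P n i ∧ P n i < Y i then (1 : ℝ) else 0) -
    (N : ℝ) * ∏ i, Y i

/-- `P` is a `(t,m,s)`-net in base 2: every elementary dyadic box of volume
`2^(t-m)` contains exactly `2^t` of the points. -/
def IsNet (t m s : ℕ) (P : Fin (2 ^ m) → Fin s → ℝ) : Prop :=
  ∀ d a : Fin s → ℕ, (∀ i, a i < 2 ^ d i) → (∑ i, d i) + t = m →
    (Finset.univ.filter fun n => ∀ i,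
        (a i : ℝ) / 2 ^ d i ≤ P n i ∧ P n i < ((a i : ℝ) + 1) / 2 ^ d i).card = 2 ^ t

/-- The digits `x_{n,i,j}` of the `n`-th point of the dyadic digital net with
generating matrices `C`. -/
def netDig (m s : ℕ) (C : Fin s → Matrix (Fin m) (Fin m) (ZMod 2)) (n : ℕ) :
    Fin s → Fin m → ZMod 2 :=
  fun i j => ∑ r : Fin m, C i j r * (if n.testBit r then 1 else 0)

/-- The `n`-th point of the dyadic digital net with generating matrices `C`. -/
def netPoint (m s : ℕ) (C : Fin s → Matrix (Fin m) (Fin m) (ZMod 2)) (n : ℕ) :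
    Fin s → ℝ :=
  fun i => ∑ j : Fin m, ((netDig m s C n i j).val : ℝ) / 2 ^ ((j : ℕ) + 1)

/-- The unit cube `[0,1]^s`. -/
def cube (s : ℕ) : Set (Fin s → ℝ) := Set.univ.pi fun _ => Set.Icc (0 : ℝ) 1

/-- The point of `Q^s(2^m)` with coordinates `T i / 2^m`. -/
def Qpt {s : ℕ} (m : ℕ) (T : Fin s → Fin (2 ^ m)) : Fin s → ℝ :=
  fun i => ((T i : ℕ) : ℝ) / 2 ^ m

/-- `M_{s,p}(P) = (2^{-sm} ∑_{T ∈ Q^s(2^m)} ∫_{[0,1]^s} |D(P ⊕ T, Y)|^p dY)^{1/p}`. -/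
def Msp (s m : ℕ) (p : ℝ) {N : ℕ} (P : Fin N → Fin s → ℝ) : ℝ :=
  ((2 : ℝ) ^ (-(s * m : ℤ)) * ∑ T : Fin s → Fin (2 ^ m),
      ∫ Y in cube s, |Dloc (fun n => xorVec (P n) (Qpt m T)) Y| ^ p) ^ (1 / p)

/-- The standard normal distribution function `Φ`. -/
def PhiCDF (w : ℝ) : ℝ :=
  (Real.sqrt (2 * Real.pi))⁻¹ * ∫ u in Set.Iio w, Real.exp (-u ^ 2 / 2)

/-- `χ_p`, the `p`-th absolute moment of the standard Gaussian. -/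
def chiMoment (p : ℝ) : ℝ :=
  (Real.sqrt (2 * Real.pi))⁻¹ * ∫ u : ℝ, |u| ^ p * Real.exp (-u ^ 2 / 2)

/-- Digits `y_{n,i,j}` of the points of the dyadic digital sequence generated by
the `ℕ × ℕ` matrices `C` over `F_2`. -/
def seqDig (s : ℕ) (C : Fin s → ℕ → ℕ → ZMod 2) (n : ℕ) : Fin s → ℕ → ZMod 2 :=
  fun i j => ∑ r ∈ Finset.range (n + 1), C i j r * (if n.testBit r then 1 else 0)

/-- The `n`-th point of the dyadic digital sequence generated by `C`. -/
def seqPoint (s : ℕ) (C : Fin s → ℕ → ℕ → ZMod 2) (n : ℕ) : Fin s → ℝ :=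
  fun i => ∑' j : ℕ, ((seqDig s C n i j).val : ℝ) / 2 ^ (j + 1)

/-- The digital sequence generated by `C` is a dyadic digital `(T,s)`-sequence:
for all `m ≥ 1` and `k ≥ 0` the block `X_{k2^m}, …, X_{k2^m+2^m-1}` is a
`(T(m),m,s)`-net in base 2. -/
def IsTSeq (s : ℕ) (Tf : ℕ → ℕ) (C : Fin s → ℕ → ℕ → ZMod 2) : Prop :=
  (∀ m, Tf m ≤ m) ∧
  ∀ m, 1 ≤ m → ∀ k : ℕ,
    IsNet (Tf m) m s fun n : Fin (2 ^ m) => seqPoint s C (k * 2 ^ m + (n : ℕ))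

/-- The dual net `P_m^⊥` of the digital net generated by `C`. -/
def dualNet (m s : ℕ) (C : Fin s → Matrix (Fin m) (Fin m) (ZMod 2)) :
    Finset (Fin s → Fin m → ZMod 2) :=
  Finset.univ.filter fun mm => ∀ n : Fin (2 ^ m),
    (∑ i, ∑ j, mm i j * netDig m s C (n : ℕ) i j) = 0

/-- `ρ(b)`: the position of the last nonzero digit (`ρ(0) = 0`). -/
def rhoF {m : ℕ} (b : Fin m → ZMod 2) : ℕ :=
  (Finset.univ.filter fun j => b j ≠ 0).sup fun j => (j : ℕ) + 1

/-- The 1-indexed component `𝔪_{i,a}` (as `0` or `1`), with the convention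
`𝔪_{i,0} = 0`. -/
def mAt {m : ℕ} (b : Fin m → ZMod 2) (a : ℕ) : ℕ :=
  if h : 1 ≤ a ∧ a ≤ m then (b ⟨a - 1, by omega⟩).val else 0

/-- The 1-indexed digit of a digit array, with the convention that digit `0`
and digits beyond `m` are `0`. -/
def dAt {m : ℕ} (y : Fin m → Fin 2) (a : ℕ) : ℕ :=
  if h : 1 ≤ a ∧ a ≤ m then (y ⟨a - 1, by omega⟩).val else 0

/-- `κ(A)`: the number of nonzero entries of `A`. -/
def kapF {s : ℕ} (A : Fin s → ℕ) : ℕ := (Finset.univ.filter fun i => A i ≠ 0).card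

/-- `a₀(A) = a₁ + ⋯ + a_s`. -/
def a0F {s : ℕ} (A : Fin s → ℕ) : ℕ := ∑ i, A i

/-- `Λ_A(T ⊕ Y^{(m)})` as a function of the digit arrays `t`, `y` of `T`, `Y`:
`∑_{𝔪 ∈ P^{⊥,*}, ρ(𝔪_i) ≤ a_i} e(∑_i (∑_j 𝔪_{i,j}(t_{i,j}+y_{i,j}) + 𝔪_{i,a_i}))`,
where `e(n) = exp(πin) = (-1)^n`. -/
def LamF (m s : ℕ) (C : Fin s → Matrix (Fin m) (Fin m) (ZMod 2)) (A : Fin s → ℕ)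
    (t y : Fin s → Fin m → Fin 2) : ℝ :=
  ∑ mm ∈ (dualNet m s C).filter fun mm => mm ≠ 0 ∧ ∀ i, rhoF (mm i) ≤ A i,
    (-1 : ℝ) ^
      (∑ i, ((∑ j, (mm i j).val * ((t i j : ℕ) + (y i j : ℕ))) + mAt (mm i) (A i)))

/-- The Rademacher function `r_A(Y)` as a function of the digit array of `Y`. -/
def rademF {m s : ℕ} (A : Fin s → ℕ) (y : Fin s → Fin m → Fin 2) : ℝ :=
  ∏ i, (-1 : ℝ) ^ dAt (y i) (A i)

/-- `Ψ_A = (-1)^{κ(A)} 2^{m-s-a₀(A)} r_A(Y) Λ_A(T ⊕ Y^{(m)})` at digit level. -/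
def PsiF (m s : ℕ) (C : Fin s → Matrix (Fin m) (Fin m) (ZMod 2)) (A : Fin s → ℕ)
    (t y : Fin s → Fin m → Fin 2) : ℝ :=
  (-1 : ℝ) ^ kapF A * (2 : ℝ) ^ ((m : ℤ) - (s : ℤ) - (a0F A : ℤ)) *
    rademF A y * LamF m s C A t y

/-- `V₀ = 10 log₂ m`. -/
def V0 (m : ℕ) : ℝ := 10 * Real.logb 2 m

/-- `I_{m,s,k} = {A ∈ I_m^s : max_i a_i = k, a₀(A) ∈ (m - t_m, m + V₀)}`. -/
def IndexSet (m s tm k : ℕ) : Finset (Fin s → ℕ) :=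
  (Fintype.piFinset fun _ : Fin s => Finset.range (m + 1)).filter fun A =>
    Finset.univ.sup A = k ∧ ((m : ℝ) - tm < a0F A ∧ (a0F A : ℝ) < m + V0 m)

/-- `I_{m,s,m+1} = {A ∈ I_m^s : a₀(A) ≥ m + V₀}`. -/
def IndexTail (m s : ℕ) : Finset (Fin s → ℕ) :=
  (Fintype.piFinset fun _ : Fin s => Finset.range (m + 1)).filter fun A =>
    (m : ℝ) + V0 m ≤ (a0F A : ℝ)

/-- `𝔇_k(T,Y) = ∑_{A ∈ I_{m,s,k}} Ψ_A` at digit level. -/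
def DDk (m s tm : ℕ) (C : Fin s → Matrix (Fin m) (Fin m) (ZMod 2)) (k : ℕ)
    (t y : Fin s → Fin m → Fin 2) : ℝ :=
  ∑ A ∈ IndexSet m s tm k, PsiF m s C A t y

/-- `R(T,Y) = ∑_{A ∈ I_{m,s,m+1}} Ψ_A` at digit level. -/
def Rtail (m s : ℕ) (C : Fin s → Matrix (Fin m) (Fin m) (ZMod 2))
    (t y : Fin s → Fin m → Fin 2) : ℝ :=
  ∑ A ∈ IndexTail m s, PsiF m s C A t y

/-- `E^{(m)}_{Y,T}(f)`: the average of `f` over all digit arrays. -/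
def Em (m s : ℕ) (f : (Fin s → Fin m → Fin 2) → (Fin s → Fin m → Fin 2) → ℝ) : ℝ :=
  (2 : ℝ) ^ (-(2 * s * m : ℤ)) *
    ∑ t : Fin s → Fin m → Fin 2, ∑ y : Fin s → Fin m → Fin 2, f t y

/-- Keep the first `k` digits of `t`, replace the remaining ones by those of `t'`. -/
def mergeDig {m s : ℕ} (k : ℕ) (t t' : Fin s → Fin m → Fin 2) :
    Fin s → Fin m → Fin 2 :=
  fun i j => if (j : ℕ) < k then t i j else t' i j

/-- The conditional expectation `E^{(m)}_{Y,T}(f | F_k)` with respect to the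
σ-field `F_k` generated by the dyadic cubes of side `2^{-k}`: the average of `f`
over the digits of index `> k`, as a function of the digit arrays `t`, `y`. -/
def EmCond (m s k : ℕ)
    (f : (Fin s → Fin m → Fin 2) → (Fin s → Fin m → Fin 2) → ℝ)
    (t y : Fin s → Fin m → Fin 2) : ℝ :=
  (2 : ℝ) ^ (-(2 * s * m : ℤ)) *
    ∑ t' : Fin s → Fin m → Fin 2, ∑ y' : Fin s → Fin m → Fin 2,
      f (mergeDig k t t') (mergeDig k y y')

/-- `Θ_{A₁,A₂,k} = E^{(m)}_{Y,T}(Ψ_{A₁}Ψ_{A₂} | F_{k-1}) - E^{(m)}_{Y,T}(Ψ_{A₁}Ψ_{A₂})`. -/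
def ThetaF (m s : ℕ) (C : Fin s → Matrix (Fin m) (Fin m) (ZMod 2))
    (A1 A2 : Fin s → ℕ) (k : ℕ) (t y : Fin s → Fin m → Fin 2) : ℝ :=
  EmCond m s (k - 1) (fun t' y' => PsiF m s C A1 t' y' * PsiF m s C A2 t' y') t y -
    Em m s fun t' y' => PsiF m s C A1 t' y' * PsiF m s C A2 t' y'

/-- `Υ_{d₁,d₂,d₃,J,k}` for a partition `J = (J₁,J₂,J₃)` of `{1,…,s}` and
`k = (k₁,k₂)`. -/
def Ups (m s tm : ℕ) (C : Fin s → Matrix (Fin m) (Fin m) (ZMod 2))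
    (J1 J2 J3 : Finset (Fin s)) (k1 k2 : ℕ) : ℝ :=
  ∑ A1 ∈ IndexSet m s tm k1, ∑ A2 ∈ IndexSet m s tm k1,
    ∑ A3 ∈ IndexSet m s tm k2, ∑ A4 ∈ IndexSet m s tm k2,
      (Em m s fun t y => ThetaF m s C A1 A2 k1 t y * ThetaF m s C A3 A4 k2 t y) *
        (if (Finset.univ.filter fun i => A1 i = A2 i) = J1 ∧
            (Finset.univ.filter fun i => A1 i < A2 i) = J2 ∧
            (Finset.univ.filter fun i => A2 i < A1 i) = J3 ∧
            (Finset.univ.filter fun i => A3 i = A4 i) = J1 ∧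
            (Finset.univ.filter fun i => A3 i < A4 i) = J2 ∧
            (Finset.univ.filter fun i => A4 i < A3 i) = J3 then (1 : ℝ) else 0)

/-- The array of the first `m` dyadic digits of the coordinates of `Y`. -/
def digitsOf (m s : ℕ) (Y : Fin s → ℝ) : Fin s → Fin m → Fin 2 :=
  fun i j => ⟨bdigit ((j : ℕ) + 1) (Y i), by unfold bdigit; omega⟩

/-- Truncation `y^{(m)}` to the first `m` dyadic digits. -/
def truncR (m : ℕ) (y : ℝ) : ℝ :=
  ∑ j ∈ Finset.range m, (bdigit (j + 1) y : ℝ) / 2 ^ (j + 1)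

/-- The elementary interval `Π_a` (`Π_0 = [0,1)`, `Π_a = [2^{-a}, 2^{1-a})`). -/
def PiBox (a : ℕ) : Set ℝ :=
  if a = 0 then Set.Ico 0 1 else Set.Ico ((2 : ℝ) ^ (-(a : ℤ))) ((2 : ℝ) ^ (1 - (a : ℤ)))

/-- `λ_A(Y) = 1_{Π_A}(Y) - vol(Π_A)`. -/
def lamA {s : ℕ} (A : Fin s → ℕ) (Y : Fin s → ℝ) : ℝ :=
  (if ∀ i, Y i ∈ PiBox (A i) then (1 : ℝ) else 0) - (2 : ℝ) ^ (-(a0F A : ℤ))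

/-- The micro-local discrepancy `λ_A(P_m^{(m)} ⊕ T ⊕ Y^{(m)})`. -/
def lamNet (m s : ℕ) (C : Fin s → Matrix (Fin m) (Fin m) (ZMod 2))
    (T Y : Fin s → ℝ) (A : Fin s → ℕ) : ℝ :=
  ∑ n : Fin (2 ^ m),
    lamA A fun i =>
      xorReal (xorReal (truncR m (netPoint m s C (n : ℕ) i)) (T i)) (truncR m (Y i))

/-- The Rademacher function `r_A(Y)` for a real point `Y`. -/
def rademReal {s : ℕ} (A : Fin s → ℕ) (Y : Fin s → ℝ) : ℝ :=
  ∏ i, if A i = 0 then (1 : ℝ) else 1 - 2 * (bdigit (A i) (Y i) : ℝ)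

/-- The truncated discrepancy
`D^{(m)}(P_m ⊕ T, Y) = 2^{-s} ∑_{A ∈ I_m^s} (-1)^{κ(A)} λ_A(P_m^{(m)} ⊕ T ⊕ Y^{(m)}) r_A(Y)`. -/
def Dm (m s : ℕ) (C : Fin s → Matrix (Fin m) (Fin m) (ZMod 2)) (T Y : Fin s → ℝ) : ℝ :=
  (2 : ℝ) ^ (-(s : ℤ)) *
    ∑ A ∈ Fintype.piFinset fun _ : Fin s => Finset.range (m + 1),
      (-1 : ℝ) ^ kapF A * lamNet m s C T Y A * rademReal A Y

/-- `𝔼_{Y,T,m}(f) = 2^{-sm} ∑_{T ∈ Q^s(2^m)} ∫_{[0,1]^s} f(T,Y) dY`. -/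
def EE (m s : ℕ) (f : (Fin s → ℝ) → (Fin s → ℝ) → ℝ) : ℝ :=
  (2 : ℝ) ^ (-(s * m : ℤ)) * ∑ T : Fin s → Fin (2 ^ m), ∫ Y in cube s, f (Qpt m T) Y

section Averages

variable {m s : ℕ}

theorem Em_translate (h g : Fin s → Fin m → Fin 2)
    (f : (Fin s → Fin m → Fin 2) → (Fin s → Fin m → Fin 2) → ℝ) :
    Em m s (fun t y => f (t + h) (y + g)) = Em m s f := by
  unfold Em
  congr 1
  rw [← Equiv.sum_comp (Equiv.addRight h) (fun t => ∑ y, f t y)]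
  refine Finset.sum_congr rfl fun t _ => ?_
  exact Equiv.sum_comp (Equiv.addRight g) (fun y => f (t + h) y)

theorem mergeDig_add (k : ℕ) (t t' h : Fin s → Fin m → Fin 2) :
    mergeDig k (t + h) (t' + h) = mergeDig k t t' + h := by
  funext i j
  simp only [mergeDig, Pi.add_apply]
  split_ifs <;> rfl

theorem mergeDig_add_left {k : ℕ} {h : Fin s → Fin m → Fin 2}
    (hh : ∀ i, ∀ j : Fin m, (j : ℕ) < k → h i j = 0) (t t' : Fin s → Fin m → Fin 2) :
    mergeDig k (t + h) t' = mergeDig k t t' := by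
  funext i j
  simp only [mergeDig, Pi.add_apply]
  split_ifs with hj
  · rw [hh i j hj, add_zero]
  · rfl

theorem EmCond_eq_Em (k : ℕ)
    (f : (Fin s → Fin m → Fin 2) → (Fin s → Fin m → Fin 2) → ℝ)
    (t y : Fin s → Fin m → Fin 2) :
    EmCond m s k f t y = Em m s fun t' y' => f (mergeDig k t t') (mergeDig k y y') := rfl

theorem EmCond_translate (k : ℕ) (h g : Fin s → Fin m → Fin 2)
    (f : (Fin s → Fin m → Fin 2) → (Fin s → Fin m → Fin 2) → ℝ)
    (t y : Fin s → Fin m → Fin 2) :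
    EmCond m s k f (t + h) (y + g) = EmCond m s k (fun t y => f (t + h) (y + g)) t y := by
  rw [EmCond_eq_Em, EmCond_eq_Em, ← Em_translate h g
    (fun t' y' => f (mergeDig k (t + h) t') (mergeDig k (y + g) y'))]
  simp only [mergeDig_add]

theorem Em_const_mul (c : ℝ)
    (f : (Fin s → Fin m → Fin 2) → (Fin s → Fin m → Fin 2) → ℝ) :
    Em m s (fun t y => c * f t y) = c * Em m s f := by
  unfold Em
  simp only [← Finset.mul_sum]
  ring

theorem Em_sum {ι : Type*} (S : Finset ι)
    (f : ι → (Fin s → Fin m → Fin 2) → (Fin s → Fin m → Fin 2) → ℝ) :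
    Em m s (fun t y => ∑ p ∈ S, f p t y) = ∑ p ∈ S, Em m s (f p) := by
  unfold Em
  rw [← Finset.mul_sum, Finset.sum_comm (s := S)]
  congr 1
  refine Finset.sum_congr rfl fun t _ => ?_
  rw [Finset.sum_comm]

theorem EmCond_const_mul (k : ℕ) (c : ℝ)
    (f : (Fin s → Fin m → Fin 2) → (Fin s → Fin m → Fin 2) → ℝ)
    (t y : Fin s → Fin m → Fin 2) :
    EmCond m s k (fun t y => c * f t y) t y = c * EmCond m s k f t y := by
  simp only [EmCond_eq_Em, Em_const_mul]

theorem EmCond_sum {ι : Type*} (k : ℕ) (S : Finset ι)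
    (f : ι → (Fin s → Fin m → Fin 2) → (Fin s → Fin m → Fin 2) → ℝ)
    (t y : Fin s → Fin m → Fin 2) :
    EmCond m s k (fun t y => ∑ p ∈ S, f p t y) t y = ∑ p ∈ S, EmCond m s k (f p) t y := by
  simp only [EmCond_eq_Em, Em_sum]

theorem Em_const (c : ℝ) : Em m s (fun _ _ => c) = c := by
  have h : ((2 : ℝ) ^ (-(2 * s * m : ℤ))) = ((2 : ℝ) ^ (2 * s * m))⁻¹ := by
    rw [zpow_neg]
    norm_cast
  unfold Em
  rw [h]
  simp only [Finset.sum_const, Finset.card_univ, Fintype.card_pi, Fintype.card_fin,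
    Finset.prod_const, nsmul_eq_mul, Nat.cast_pow, Nat.cast_ofNat]
  have : (2 : ℝ) ^ (2 * s * m) = ((2 ^ m) ^ s) * ((2 ^ m) ^ s) := by
    rw [← pow_mul, ← pow_add]
    congr 1
    ring
  rw [this]
  field_simp

theorem abs_Em_le {f : (Fin s → Fin m → Fin 2) → (Fin s → Fin m → Fin 2) → ℝ} {b : ℝ}
    (hf : ∀ t y, |f t y| ≤ b) : |Em m s f| ≤ b := by
  rw [← Em_const (m := m) (s := s) b]
  unfold Em
  rw [abs_mul, abs_of_pos (zpow_pos two_pos _)]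
  refine mul_le_mul_of_nonneg_left ?_ (zpow_pos two_pos _).le
  refine (Finset.abs_sum_le_sum_abs _ _).trans (Finset.sum_le_sum fun t _ => ?_)
  exact (Finset.abs_sum_le_sum_abs _ _).trans (Finset.sum_le_sum fun y _ => hf t y)

end Averages

section Characters

variable {m s : ℕ}

/-- The Walsh character of `t ⊕ y` with frequency `n`. -/
def walsh (n : Fin s → Fin m → ZMod 2) (t y : Fin s → Fin m → Fin 2) : ℝ :=
  ∏ i, ∏ j, (-1 : ℝ) ^ ((n i j).val * ((t i j : ℕ) + (y i j : ℕ)))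

theorem neg_one_pow_val_add (a b : Fin 2) :
    (-1 : ℝ) ^ ((a + b : Fin 2) : ℕ) = (-1) ^ (a : ℕ) * (-1) ^ (b : ℕ) := by
  fin_cases a <;> fin_cases b <;> simp

theorem walsh_translate (n : Fin s → Fin m → ZMod 2) (t y h g : Fin s → Fin m → Fin 2) :
    walsh n (t + h) (y + g) = walsh n h g * walsh n t y := by
  simp only [walsh, ← Finset.prod_mul_distrib]
  refine Finset.prod_congr rfl fun i _ => Finset.prod_congr rfl fun j _ => ?_
  simp only [Pi.add_apply, pow_add, mul_comm (n i j).val, pow_mul,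
    neg_one_pow_val_add, mul_pow]
  ring

theorem walsh_self (n : Fin s → Fin m → ZMod 2) (h : Fin s → Fin m → Fin 2) :
    walsh n h h = 1 := by
  refine Finset.prod_eq_one fun i _ => Finset.prod_eq_one fun j _ => ?_
  exact Even.neg_one_pow ((Even.add_self _).mul_left _)

theorem walsh_add (n n' : Fin s → Fin m → ZMod 2) (t y : Fin s → Fin m → Fin 2) :
    walsh (n + n') t y = walsh n t y * walsh n' t y := by
  simp only [walsh, ← Finset.prod_mul_distrib]
  refine Finset.prod_congr rfl fun i _ => Finset.prod_congr rfl fun j _ => ?_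
  have key : ∀ a b : ZMod 2, (-1 : ℝ) ^ (a + b).val = (-1) ^ a.val * (-1) ^ b.val :=
    neg_one_pow_val_add
  simp only [Pi.add_apply, pow_mul, key, mul_pow]

/-- The digit array whose only nonzero digit is at position `(i, j)`. -/
def unitDig (i : Fin s) (j : Fin m) : Fin s → Fin m → Fin 2 :=
  fun i' j' => if i' = i ∧ j' = j then 1 else 0

theorem walsh_unitDig_zero (n : Fin s → Fin m → ZMod 2) (i : Fin s) (j : Fin m) :
    walsh n (unitDig i j) 0 = (-1) ^ (n i j).val := by
  unfold walsh
  rw [Finset.prod_eq_single i, Finset.prod_eq_single j]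
  · simp [unitDig]
  · intro j' _ hj
    simp [unitDig, hj]
  · simp
  · intro i' _ hi
    exact Finset.prod_eq_one fun j' _ => by simp [unitDig, hi]
  · simp

theorem rademF_add (A : Fin s → ℕ) (y h : Fin s → Fin m → Fin 2) :
    rademF A (y + h) = rademF A h * rademF A y := by
  simp only [rademF, ← Finset.prod_mul_distrib]
  refine Finset.prod_congr rfl fun i _ => ?_
  unfold dAt
  split_ifs with hA
  · rw [Pi.add_apply, Pi.add_apply, neg_one_pow_val_add, mul_comm]
  · simp

theorem dAt_unitDig (i i' : Fin s) (j : Fin m) (a : ℕ) :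
    dAt (unitDig i j i') a = if i' = i ∧ a = j + 1 then 1 else 0 := by
  have hj := j.isLt
  unfold dAt unitDig
  by_cases h1 : 1 ≤ a ∧ a ≤ m
  · rw [dif_pos h1]
    have : (⟨a - 1, by omega⟩ : Fin m) = j ↔ a = j + 1 := by
      rw [Fin.ext_iff]
      change a - 1 = (j : ℕ) ↔ _
      omega
    simp only [this]
    split_ifs <;> rfl
  · rw [dif_neg h1, if_neg (by omega)]

theorem rademF_unitDig (A : Fin s → ℕ) (i : Fin s) (j : Fin m) :
    rademF A (unitDig i j) = if A i = j + 1 then -1 else 1 := by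
  unfold rademF
  simp only [dAt_unitDig]
  rw [Finset.prod_eq_single i]
  · split_ifs <;> simp_all
  · intro i' _ hi
    simp [hi]
  · simp

theorem rademF_sq (A : Fin s → ℕ) (y : Fin s → Fin m → Fin 2) :
    rademF A y * rademF A y = 1 := by
  simp only [rademF, ← Finset.prod_mul_distrib]
  refine Finset.prod_eq_one fun i _ => ?_
  rw [← pow_add]
  exact Even.neg_one_pow (Even.add_self _)

theorem abs_rademF (A : Fin s → ℕ) (y : Fin s → Fin m → Fin 2) : |rademF A y| = 1 := by
  simp [rademF, Finset.abs_prod]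

/-- The nonzero elements of the dual net with `ρ(𝔪_i) ≤ a_i` for all `i`. -/
def dualBelow (m s : ℕ) (C : Fin s → Matrix (Fin m) (Fin m) (ZMod 2)) (A : Fin s → ℕ) :
    Finset (Fin s → Fin m → ZMod 2) :=
  (dualNet m s C).filter fun mm => mm ≠ 0 ∧ ∀ i, rhoF (mm i) ≤ A i

theorem LamF_eq (C : Fin s → Matrix (Fin m) (Fin m) (ZMod 2)) (A : Fin s → ℕ)
    (t y : Fin s → Fin m → Fin 2) :
    LamF m s C A t y = ∑ n ∈ dualBelow m s C A,
      (-1 : ℝ) ^ (∑ i, mAt (n i) (A i)) * walsh n t y := by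
  unfold LamF dualBelow
  refine Finset.sum_congr rfl fun n _ => ?_
  rw [Finset.sum_add_distrib, pow_add, mul_comm]
  congr 1
  simp only [walsh, Finset.prod_pow_eq_pow_sum]

variable (C : Fin s → Matrix (Fin m) (Fin m) (ZMod 2))

theorem PsiF_translate (A : Fin s → ℕ) (t y h : Fin s → Fin m → Fin 2) :
    PsiF m s C A (t + h) (y + h) = rademF A h * PsiF m s C A t y := by
  simp only [PsiF, LamF_eq, walsh_translate, walsh_self, one_mul, rademF_add]
  ring

theorem ThetaF_translate (A1 A2 : Fin s → ℕ) (k : ℕ) (t y h : Fin s → Fin m → Fin 2) :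
    ThetaF m s C A1 A2 k (t + h) (y + h) =
      rademF A1 h * rademF A2 h * ThetaF m s C A1 A2 k t y := by
  have key : ∀ t y : Fin s → Fin m → Fin 2,
      PsiF m s C A1 (t + h) (y + h) * PsiF m s C A2 (t + h) (y + h) =
        (rademF A1 h * rademF A2 h) * (PsiF m s C A1 t y * PsiF m s C A2 t y) := by
    intro t y
    rw [PsiF_translate, PsiF_translate]
    ring
  unfold ThetaF
  have e := Em_translate h h fun t y => PsiF m s C A1 t y * PsiF m s C A2 t y
  simp only [key, Em_const_mul] at e
  rw [EmCond_translate]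
  simp only [key, EmCond_const_mul]
  linear_combination e

theorem ThetaF_translate_of_zero (A1 A2 : Fin s → ℕ) (k : ℕ) {h : Fin s → Fin m → Fin 2}
    (hh : ∀ i, ∀ j : Fin m, (j : ℕ) < k - 1 → h i j = 0) (t y : Fin s → Fin m → Fin 2) :
    ThetaF m s C A1 A2 k (t + h) (y + h) = ThetaF m s C A1 A2 k t y := by
  simp only [ThetaF, EmCond_eq_Em, mergeDig_add_left hh]

theorem eq_iff_eq_of_ThetaF_ne_zero {A1 A2 : Fin s → ℕ} {k : ℕ} (hk : 1 ≤ k) (hkm : k ≤ m)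
    {t y : Fin s → Fin m → Fin 2} (hne : ThetaF m s C A1 A2 k t y ≠ 0) (i : Fin s) :
    A1 i = k ↔ A2 i = k := by
  have h1 := ThetaF_translate C A1 A2 k t y (unitDig i ⟨k - 1, by omega⟩)
  rw [ThetaF_translate_of_zero] at h1
  · have h2 := mul_right_cancel₀ hne ((one_mul _).trans h1)
    simp only [rademF_unitDig, Nat.sub_add_cancel hk] at h2
    split_ifs at h2 with ha hb hb
    · simp [ha, hb]
    · norm_num at h2
    · norm_num at h2
    · simp [ha, hb]
  · intro i' j' hj
    have : j' ≠ ⟨k - 1, by omega⟩ := by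
      intro hc
      rw [hc] at hj
      exact lt_irrefl _ hj
    simp [unitDig, this]

theorem rademF_prod_of_Em_ne_zero {A1 A2 A3 A4 : Fin s → ℕ} {k1 k2 : ℕ}
    (hne : Em m s (fun t y => ThetaF m s C A1 A2 k1 t y * ThetaF m s C A3 A4 k2 t y) ≠ 0)
    (h : Fin s → Fin m → Fin 2) :
    rademF A1 h * rademF A2 h * (rademF A3 h * rademF A4 h) = 1 := by
  have h1 := Em_translate h h
    (fun t y => ThetaF m s C A1 A2 k1 t y * ThetaF m s C A3 A4 k2 t y)
  have h2 : ∀ t y : Fin s → Fin m → Fin 2,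
      ThetaF m s C A1 A2 k1 (t + h) (y + h) * ThetaF m s C A3 A4 k2 (t + h) (y + h) =
      (rademF A1 h * rademF A2 h * (rademF A3 h * rademF A4 h)) *
        (ThetaF m s C A1 A2 k1 t y * ThetaF m s C A3 A4 k2 t y) := by
    intro t y
    rw [ThetaF_translate, ThetaF_translate]
    ring
  simp only [h2, Em_const_mul] at h1
  exact mul_right_cancel₀ hne (h1.trans (one_mul _).symm)

theorem pairing_of_sign_prod {m a b c d : ℕ} (ha : a ≤ m) (hb : b ≤ m) (hc : c ≤ m) (hd : d ≤ m)
    (h : ∀ v, 1 ≤ v → v ≤ m →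
      (if a = v then (-1 : ℝ) else 1) * (if b = v then -1 else 1) *
        ((if c = v then -1 else 1) * (if d = v then -1 else 1)) = 1) :
    (a = b ∧ c = d) ∨ (a = c ∧ b = d) ∨ (a = d ∧ b = c) := by
  have key : ∀ v, 1 ≤ v → v ≤ m →
      ((a = v ↔ b = v) ↔ (c = v ↔ d = v)) := by
    intro v h1 h2
    have := h v h1 h2
    split_ifs at this with p q r t <;> simp_all <;> norm_num at this
  have ka := key a
  have kb := key b
  have kc := key c
  have kd := key d
  grind

theorem pairing_of_Em_ne_zero {A1 A2 A3 A4 : Fin s → ℕ} {k1 k2 : ℕ}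
    (h1 : ∀ i, A1 i ≤ m) (h2 : ∀ i, A2 i ≤ m) (h3 : ∀ i, A3 i ≤ m) (h4 : ∀ i, A4 i ≤ m)
    (hne : Em m s (fun t y => ThetaF m s C A1 A2 k1 t y * ThetaF m s C A3 A4 k2 t y) ≠ 0)
    (i : Fin s) :
    (A1 i = A2 i ∧ A3 i = A4 i) ∨ (A1 i = A3 i ∧ A2 i = A4 i) ∨
      (A1 i = A4 i ∧ A2 i = A3 i) := by
  refine pairing_of_sign_prod (h1 i) (h2 i) (h3 i) (h4 i) fun v hv hvm => ?_
  have := rademF_prod_of_Em_ne_zero C hne (unitDig i ⟨v - 1, by omega⟩)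
  simpa only [rademF_unitDig, Nat.sub_add_cancel hv] using this

/-- The centred conditional expectation of a Walsh character. -/
def walshCond (k : ℕ) (n : Fin s → Fin m → ZMod 2) (t y : Fin s → Fin m → Fin 2) : ℝ :=
  EmCond m s k (walsh n) t y - Em m s (walsh n)

theorem walshCond_translate (k : ℕ) (n : Fin s → Fin m → ZMod 2)
    (t y h g : Fin s → Fin m → Fin 2) :
    walshCond k n (t + h) (y + g) = walsh n h g * walshCond k n t y := by
  unfold walshCond
  have e := Em_translate h g (walsh n)
  simp only [walsh_translate, Em_const_mul] at e
  rw [EmCond_translate]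
  simp only [walsh_translate, EmCond_const_mul]
  linear_combination e

theorem walshCond_zero (k : ℕ) (t y : Fin s → Fin m → Fin 2) :
    walshCond k (0 : Fin s → Fin m → ZMod 2) t y = 0 := by
  have : walsh (0 : Fin s → Fin m → ZMod 2) = fun _ _ => 1 := by
    funext t y
    simp [walsh]
  simp [walshCond, EmCond_eq_Em, this]

theorem eq_of_Em_walshCond_ne_zero {k k' : ℕ} {n n' : Fin s → Fin m → ZMod 2}
    (hne : Em m s (fun t y => walshCond k n t y * walshCond k' n' t y) ≠ 0) : n = n' := by
  funext i j
  have h1 := Em_translate (unitDig i j) 0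
    (fun t y => walshCond k n t y * walshCond k' n' t y)
  have h2 : ∀ t y : Fin s → Fin m → Fin 2,
      walshCond k n (t + unitDig i j) (y + 0) * walshCond k' n' (t + unitDig i j) (y + 0) =
      ((-1) ^ (n i j).val * (-1) ^ (n' i j).val) *
        (walshCond k n t y * walshCond k' n' t y) := by
    intro t y
    rw [walshCond_translate, walshCond_translate, walsh_unitDig_zero, walsh_unitDig_zero]
    ring
  simp only [h2, Em_const_mul] at h1
  have h3 := mul_right_cancel₀ hne (h1.trans (one_mul _).symm)
  generalize n i j = a at h3 ⊢
  generalize n' i j = b at h3 ⊢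
  have key : ∀ a b : Fin 2, (-1 : ℝ) ^ (a : ℕ) * (-1) ^ (b : ℕ) = 1 → a = b := by
    intro a b
    fin_cases a <;> fin_cases b <;> norm_num
  exact key a b h3

theorem ne_zero_of_Em_walshCond_ne_zero {k k' : ℕ} {n n' : Fin s → Fin m → ZMod 2}
    (hne : Em m s (fun t y => walshCond k n t y * walshCond k' n' t y) ≠ 0) : n ≠ 0 := by
  rintro rfl
  simp [walshCond_zero, Em_const] at hne

theorem ThetaF_self_eq (A : Fin s → ℕ) (k : ℕ) : ∃ c : (Fin s → Fin m → ZMod 2) ×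
    (Fin s → Fin m → ZMod 2) → ℝ, ∀ t y, ThetaF m s C A A k t y =
      ∑ p ∈ dualBelow m s C A ×ˢ dualBelow m s C A, c p * walshCond (k - 1) (p.1 + p.2) t y := by
  refine ⟨fun p => ((-1 : ℝ) ^ kapF A * (2 : ℝ) ^ ((m : ℤ) - (s : ℤ) - (a0F A : ℤ))) ^ 2 *
    ((-1 : ℝ) ^ (∑ i, mAt (p.1 i) (A i)) * (-1 : ℝ) ^ (∑ i, mAt (p.2 i) (A i))), fun t y => ?_⟩
  have key : ∀ t y, PsiF m s C A t y * PsiF m s C A t y =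
      ∑ p ∈ dualBelow m s C A ×ˢ dualBelow m s C A,
        (((-1 : ℝ) ^ kapF A * (2 : ℝ) ^ ((m : ℤ) - (s : ℤ) - (a0F A : ℤ))) ^ 2 *
        ((-1 : ℝ) ^ (∑ i, mAt (p.1 i) (A i)) * (-1 : ℝ) ^ (∑ i, mAt (p.2 i) (A i)))) *
        walsh (p.1 + p.2) t y := by
    intro t y
    have h1 : PsiF m s C A t y * PsiF m s C A t y =
      ((-1 : ℝ) ^ kapF A * (2 : ℝ) ^ ((m : ℤ) - (s : ℤ) - (a0F A : ℤ))) ^ 2 *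
        (rademF A y * rademF A y) * (LamF m s C A t y * LamF m s C A t y) := by
      unfold PsiF
      ring
    rw [h1, rademF_sq, LamF_eq, Finset.sum_mul_sum, Finset.sum_product, Finset.mul_sum]
    refine Finset.sum_congr rfl fun n _ => ?_
    rw [Finset.mul_sum]
    refine Finset.sum_congr rfl fun n' _ => ?_
    rw [walsh_add]
    ring
  unfold ThetaF
  simp only [key]
  rw [EmCond_sum, Em_sum, ← Finset.sum_sub_distrib]
  refine Finset.sum_congr rfl fun p _ => ?_
  rw [EmCond_const_mul, Em_const_mul, walshCond]
  ring

theorem rhoF_le_iff (b : Fin m → ZMod 2) (a : ℕ) :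
    rhoF b ≤ a ↔ ∀ j : Fin m, a ≤ j → b j = 0 := by
  unfold rhoF
  rw [Finset.sup_le_iff]
  simp only [Finset.mem_filter, Finset.mem_univ, true_and]
  constructor
  · intro h j hj
    by_contra hb
    have := h j hb
    omega
  · intro h j hb
    by_contra hj
    exact hb (h j (by omega))

theorem mem_dualBelow {A : Fin s → ℕ} {n : Fin s → Fin m → ZMod 2} :
    n ∈ dualBelow m s C A ↔ n ∈ dualNet m s C ∧ n ≠ 0 ∧
      ∀ i, ∀ j : Fin m, A i ≤ j → n i j = 0 := by
  simp only [dualBelow, Finset.mem_filter, rhoF_le_iff]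

theorem add_mem_dualNet {n n' : Fin s → Fin m → ZMod 2} (hn : n ∈ dualNet m s C)
    (hn' : n' ∈ dualNet m s C) : n + n' ∈ dualNet m s C := by
  simp only [dualNet, Finset.mem_filter, Finset.mem_univ, true_and] at hn hn' ⊢
  intro r
  simp only [Pi.add_apply, add_mul, Finset.sum_add_distrib, hn r, hn' r, add_zero]

theorem dualBelow_inf_nonempty_of_Em_ne_zero {A B : Fin s → ℕ} {k1 k2 : ℕ}
    (hne : Em m s (fun t y => ThetaF m s C A A k1 t y * ThetaF m s C B B k2 t y) ≠ 0) :
    (dualBelow m s C (A ⊓ B)).Nonempty := by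
  obtain ⟨c, hc⟩ := ThetaF_self_eq C A k1
  obtain ⟨c', hc'⟩ := ThetaF_self_eq C B k2
  simp only [hc, hc', Finset.sum_mul_sum] at hne
  rw [Em_sum] at hne
  obtain ⟨p, hp, hne⟩ := Finset.exists_ne_zero_of_sum_ne_zero hne
  rw [Em_sum] at hne
  obtain ⟨q, hq, hne⟩ := Finset.exists_ne_zero_of_sum_ne_zero hne
  have h1 : Em m s (fun t y =>
      walshCond (k1 - 1) (p.1 + p.2) t y * walshCond (k2 - 1) (q.1 + q.2) t y) ≠ 0 := by
    intro h0
    apply hne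
    rw [show (fun t y => c p * walshCond (k1 - 1) (p.1 + p.2) t y *
      (c' q * walshCond (k2 - 1) (q.1 + q.2) t y)) = fun t y => (c p * c' q) *
      (walshCond (k1 - 1) (p.1 + p.2) t y * walshCond (k2 - 1) (q.1 + q.2) t y) by
        funext t y; ring, Em_const_mul, h0, mul_zero]
  rw [Finset.mem_product, mem_dualBelow, mem_dualBelow] at hp hq
  refine ⟨p.1 + p.2, ?_⟩
  rw [mem_dualBelow]
  refine ⟨add_mem_dualNet C hp.1.1 hp.2.1, ne_zero_of_Em_walshCond_ne_zero h1, ?_⟩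
  intro i j hj
  rw [Pi.inf_apply, inf_le_iff] at hj
  rcases hj with hj | hj
  · simp [hp.1.2.2 i j hj, hp.2.2.2 i j hj]
  · rw [eq_of_Em_walshCond_ne_zero h1]
    simp [hq.1.2.2 i j hj, hq.2.2.2 i j hj]

end Characters

section Net

theorem ofBits_eq_sum {m : ℕ} (f : Fin m → Bool) :
    Nat.ofBits f = ∑ j, (f j).toNat * 2 ^ (j : ℕ) := by
  induction m with
  | zero => simp
  | succ m ih =>
    rw [Nat.ofBits_succ, ih, Fin.sum_univ_succ, Finset.mul_sum]
    simp only [Function.comp, Fin.val_zero, pow_zero, mul_one, Fin.val_succ, pow_succ]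
    rw [add_comm]
    congr 1
    refine Finset.sum_congr rfl fun j _ => ?_
    ring

/-- The integer whose binary digits, most significant first, are `x`. -/
def digitInt {m : ℕ} (x : Fin m → ZMod 2) : ℕ :=
  Nat.ofBits fun j : Fin m => decide (x j.rev ≠ 0)

theorem val_eq_toNat (a : ZMod 2) : (decide (a ≠ 0)).toNat = a.val := by
  revert a
  have : ∀ a : Fin 2, (decide (a ≠ 0)).toNat = (a : ℕ) := by
    intro a
    fin_cases a <;> simp
  exact this

theorem digitInt_div {m : ℕ} (x : Fin m → ZMod 2) :
    ∑ j : Fin m, ((x j).val : ℝ) / 2 ^ ((j : ℕ) + 1) = (digitInt x : ℝ) / 2 ^ m := by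
  rw [digitInt, ofBits_eq_sum, ← Equiv.sum_comp Fin.revPerm]
  push_cast
  rw [Finset.sum_div]
  refine Finset.sum_congr rfl fun j _ => ?_
  rw [Fin.revPerm_apply, val_eq_toNat, div_eq_div_iff (by positivity) (by positivity),
    mul_assoc, ← pow_add, Fin.val_rev]
  congr 2
  omega

theorem digit_eq_of_mem_box {m d a : ℕ} (hd : d ≤ m) (x : Fin m → ZMod 2)
    (h1 : (a : ℝ) / 2 ^ d ≤ (digitInt x : ℝ) / 2 ^ m)
    (h2 : (digitInt x : ℝ) / 2 ^ m < ((a : ℝ) + 1) / 2 ^ d) (j : Fin m) (hj : (j : ℕ) < d) :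
    x j ≠ 0 ↔ a.testBit (d - 1 - j) = true := by
  have hm : (2 : ℝ) ^ m = 2 ^ d * 2 ^ (m - d) := by
    rw [← pow_add]
    congr 1
    omega
  rw [div_le_div_iff₀ (by positivity) (by positivity), hm] at h1
  rw [div_lt_div_iff₀ (by positivity) (by positivity), hm] at h2
  have hpos : (0 : ℝ) < 2 ^ d := by positivity
  have h1' : a * 2 ^ (m - d) ≤ digitInt x := by
    have : (a : ℝ) * 2 ^ (m - d) ≤ digitInt x := by
      refine le_of_mul_le_mul_right ?_ hpos
      linarith
    exact_mod_cast this
  have h2' : digitInt x < (a + 1) * 2 ^ (m - d) := by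
    have : (digitInt x : ℝ) < (a + 1) * 2 ^ (m - d) := by
      refine lt_of_mul_lt_mul_right ?_ hpos.le
      linarith
    exact_mod_cast this
  have h3 : digitInt x >>> (m - d) = a := by
    rw [Nat.shiftRight_eq_div_pow]
    exact Nat.div_eq_of_lt_le h1' h2'
  have hjm := j.isLt
  rw [← h3, Nat.testBit_shiftRight, digitInt, Nat.testBit_ofBits_lt _ _ (by omega)]
  rw [decide_eq_true_iff]
  have : (⟨m - d + (d - 1 - j), by omega⟩ : Fin m).rev = j := by
    rw [Fin.ext_iff, Fin.val_rev]
    change m - (m - d + (d - 1 - j) + 1) = (j : ℕ)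
    omega
  rw [this]

variable {m s tm : ℕ} (C : Fin s → Matrix (Fin m) (Fin m) (ZMod 2))

theorem exists_point_of_digits
    (hnet : IsNet tm m s (fun n : Fin (2 ^ m) => netPoint m s C (n : ℕ)))
    {B : Fin s → ℕ} (hB : ∑ i, B i + tm = m) (e : Fin s → Fin m → ZMod 2) :
    ∃ n : Fin (2 ^ m), ∀ i, ∀ j : Fin m, (j : ℕ) < B i → netDig m s C n i j = e i j := by
  have hBm : ∀ i, B i ≤ m := fun i =>
    (Finset.single_le_sum (f := B) (fun _ _ => Nat.zero_le _) (Finset.mem_univ i)).trans (by omega)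
  let a : Fin s → ℕ := fun i => digitInt fun j : Fin (B i) => e i (Fin.castLE (hBm i) j)
  have hcard := hnet B a (fun i => Nat.ofBits_lt_two_pow _) hB
  have hne : (Finset.univ.filter fun n : Fin (2 ^ m) => ∀ i,
      (a i : ℝ) / 2 ^ B i ≤ netPoint m s C n i ∧
        netPoint m s C n i < ((a i : ℝ) + 1) / 2 ^ B i).Nonempty := by
    rw [← Finset.card_pos, hcard]
    positivity
  obtain ⟨n, hn⟩ := hne
  rw [Finset.mem_filter] at hn
  refine ⟨n, fun i j hj => ?_⟩
  have h := hn.2 i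
  simp only [netPoint, digitInt_div] at h
  have h1 := digit_eq_of_mem_box (hBm i) _ h.1 h.2 j hj
  have h2 : (a i).testBit (B i - 1 - j) = true ↔ e i j ≠ 0 := by
    change (digitInt _).testBit _ = true ↔ _
    rw [digitInt, Nat.testBit_ofBits_lt _ _ (by omega), decide_eq_true_iff]
    have : Fin.castLE (hBm i) (⟨B i - 1 - j, by omega⟩ : Fin (B i)).rev = j := by
      rw [Fin.ext_iff, Fin.val_castLE, Fin.val_rev]
      change B i - (B i - 1 - j + 1) = (j : ℕ)
      omega
    rw [this]
  have key : ∀ a b : Fin 2, (a ≠ 0 ↔ b ≠ 0) → a = b := by decide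
  exact key _ _ (h1.trans h2)

/-- A vector below `A` with prescribed sum. -/
theorem exists_le_sum_eq {ι : Type*} [Fintype ι] (A : ι → ℕ) {r : ℕ} (hr : r ≤ ∑ i, A i) :
    ∃ B : ι → ℕ, (∀ i, B i ≤ A i) ∧ ∑ i, B i = r := by
  induction r with
  | zero => exact ⟨0, fun i => Nat.zero_le _, by simp⟩
  | succ r ih =>
    obtain ⟨B, hB, hs⟩ := ih (by omega)
    obtain ⟨i, -, hi⟩ : ∃ i ∈ Finset.univ, B i < A i := by
      apply Finset.exists_lt_of_sum_lt
      omega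
    refine ⟨B + Pi.single i 1, fun l => ?_, ?_⟩
    · by_cases hl : l = i
      · subst hl
        simpa using hi
      · simpa [hl] using hB l
    · simp [Finset.sum_add_distrib, hs]

theorem eq_zero_of_mem_dualNet
    (hnet : IsNet tm m s (fun n : Fin (2 ^ m) => netPoint m s C (n : ℕ)))
    {B : Fin s → ℕ} (hB : ∑ i, B i + tm = m) {n : Fin s → Fin m → ZMod 2}
    (hn : n ∈ dualNet m s C) (hnB : ∀ i, ∀ j : Fin m, B i ≤ j → n i j = 0) : n = 0 := by
  funext i j
  by_contra hij
  obtain ⟨r, hr⟩ := exists_point_of_digits C hnet hB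
    (fun i' j' => if i' = i ∧ j' = j then 1 else 0)
  simp only [dualNet, Finset.mem_filter, Finset.mem_univ, true_and] at hn
  have h1 := hn r
  have h2 : ∀ i' j', n i' j' * netDig m s C r i' j' =
      if i' = i then (if j' = j then n i j else 0) else 0 := by
    intro i' j'
    by_cases hj : (j' : ℕ) < B i'
    · rw [hr i' j' hj]
      split_ifs <;> simp_all
    · rw [hnB i' j' (by omega), zero_mul]
      split_ifs with ha hb
      · subst ha hb
        exact (hnB _ _ (by omega)).symm
      · rfl
      · rfl
  simp only [h2] at h1
  rw [Finset.sum_comm] at h1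
  simp at h1
  exact hij h1

theorem lt_sum_of_dualBelow_nonempty
    (hnet : IsNet tm m s (fun n : Fin (2 ^ m) => netPoint m s C (n : ℕ))) (htm : tm ≤ m)
    {A : Fin s → ℕ} (hA : (dualBelow m s C A).Nonempty) (hs : 0 < s) :
    m - tm < ∑ i, A i := by
  obtain ⟨n, hn⟩ := hA
  rw [mem_dualBelow] at hn
  by_contra hlt
  let e : Fin s → ℕ := Pi.single ⟨0, hs⟩ (m - tm - ∑ i, A i)
  have he : ∑ i, (A + e) i + tm = m := by
    have : ∑ i, e i = m - tm - ∑ i, A i := by simp [e]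
    simp only [Pi.add_apply, Finset.sum_add_distrib, this]
    omega
  refine hn.2.1 (eq_zero_of_mem_dualNet C hnet he hn.1 fun i j hj => hn.2.2 i j ?_)
  rw [Pi.add_apply] at hj
  omega

theorem card_dualBelow_le
    (hnet : IsNet tm m s (fun n : Fin (2 ^ m) => netPoint m s C (n : ℕ))) (htm : tm ≤ m)
    {A : Fin s → ℕ} (hA : m - tm ≤ ∑ i, A i) :
    (dualBelow m s C A).card ≤ 2 ^ (∑ i, A i - (m - tm)) := by
  obtain ⟨B, hBA, hB⟩ := exists_le_sum_eq A hA
  have hcard : (Finset.univ : Finset (∀ i : Fin s, Fin (A i - B i) → Fin 2)).card =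
      2 ^ (∑ i, A i - (m - tm)) := by
    simp only [Finset.card_univ, Fintype.card_pi, Fintype.card_fin, Finset.prod_const,
      Finset.prod_pow_eq_pow_sum]
    rw [Finset.sum_tsub_distrib _ (fun i _ => hBA i), hB]
  rw [← hcard]
  let φ : (Fin s → Fin m → ZMod 2) → ∀ i : Fin s, Fin (A i - B i) → Fin 2 :=
    fun n i j => if h : B i + j < m then n i ⟨B i + j, h⟩ else 0
  refine Finset.card_le_card_of_injOn φ (fun _ _ => Finset.mem_univ _) ?_
  intro n hn n' hn' hφ
  rw [Finset.mem_coe, mem_dualBelow] at hn hn'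
  have hz : n + n' = 0 := by
    refine eq_zero_of_mem_dualNet C hnet (B := B) (by omega)
      (add_mem_dualNet C hn.1 hn'.1) fun i j hj => ?_
    by_cases hjA : A i ≤ j
    · simp [hn.2.2 i j hjA, hn'.2.2 i j hjA]
    · have hval : ∀ n : Fin s → Fin m → ZMod 2, φ n i ⟨j - B i, by omega⟩ = n i j := by
        intro n
        have h2 : B i + (j - B i) = (j : ℕ) := by omega
        change (if h : B i + (j - B i) < m then n i ⟨B i + (j - B i), h⟩ else 0) = n i j
        rw [dif_pos (by omega)]
        exact congrArg (n i) (Fin.ext h2)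
      have h1 := congrFun (congrFun hφ i) ⟨j - B i, by omega⟩
      rw [hval, hval] at h1
      rw [Pi.add_apply, Pi.add_apply]
      have key : ∀ a b : Fin 2, a = b → a + b = 0 := by decide
      exact key _ _ h1
  funext i j
  have key : ∀ a b : Fin 2, a + b = 0 → a = b := by decide
  exact key _ _ (congrFun (congrFun hz i) j)

theorem abs_PsiF_le
    (hnet : IsNet tm m s (fun n : Fin (2 ^ m) => netPoint m s C (n : ℕ))) (htm : tm ≤ m)
    {A : Fin s → ℕ} (hA : m - tm ≤ ∑ i, A i) (t y : Fin s → Fin m → Fin 2) :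
    |PsiF m s C A t y| ≤ 2 ^ tm := by
  have h1 : |LamF m s C A t y| ≤ (2 : ℝ) ^ (∑ i, A i - (m - tm)) := by
    rw [LamF_eq]
    refine (Finset.abs_sum_le_sum_abs _ _).trans ?_
    have h2 : ∀ n ∈ dualBelow m s C A,
        |(-1 : ℝ) ^ (∑ i, mAt (n i) (A i)) * walsh n t y| = 1 := by
      intro n _
      simp [abs_mul, walsh, Finset.abs_prod]
    rw [Finset.sum_congr rfl h2, Finset.sum_const, nsmul_eq_mul, mul_one]
    exact_mod_cast card_dualBelow_le C hnet htm hA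
  unfold PsiF
  rw [abs_mul, abs_mul, abs_mul, abs_rademF, abs_pow, abs_neg, abs_one, one_pow, one_mul, mul_one,
    abs_of_pos (zpow_pos two_pos _)]
  calc (2 : ℝ) ^ ((m : ℤ) - s - a0F A) * |LamF m s C A t y|
      ≤ (2 : ℝ) ^ ((m : ℤ) - s - a0F A) * (2 : ℝ) ^ (∑ i, A i - (m - tm)) :=
        mul_le_mul_of_nonneg_left h1 (zpow_pos two_pos _).le
    _ = (2 : ℝ) ^ ((tm : ℤ) - s) := by
        rw [← zpow_natCast, ← zpow_add₀ two_ne_zero]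
        congr 1
        unfold a0F
        omega
    _ ≤ (2 : ℝ) ^ (tm : ℤ) := zpow_le_zpow_right₀ one_le_two (by omega)
    _ = 2 ^ tm := zpow_natCast _ _

theorem abs_ThetaF_le
    (hnet : IsNet tm m s (fun n : Fin (2 ^ m) => netPoint m s C (n : ℕ))) (htm : tm ≤ m)
    {A B : Fin s → ℕ} (hA : m - tm ≤ ∑ i, A i) (hB : m - tm ≤ ∑ i, B i) (k : ℕ)
    (t y : Fin s → Fin m → Fin 2) :
    |ThetaF m s C A B k t y| ≤ 2 * 4 ^ tm := by
  have h : ∀ t y, |PsiF m s C A t y * PsiF m s C B t y| ≤ 4 ^ tm := by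
    intro t y
    rw [abs_mul, show (4 : ℝ) = 2 * 2 by norm_num, mul_pow]
    exact mul_le_mul (abs_PsiF_le C hnet htm hA t y) (abs_PsiF_le C hnet htm hB t y)
      (abs_nonneg _) (by positivity)
  unfold ThetaF
  rw [EmCond_eq_Em, two_mul]
  exact (abs_sub _ _).trans (add_le_add (abs_Em_le fun _ _ => h _ _) (abs_Em_le h))

theorem abs_Em_ThetaF_mul_le
    (hnet : IsNet tm m s (fun n : Fin (2 ^ m) => netPoint m s C (n : ℕ))) (htm : tm ≤ m)
    {A1 A2 A3 A4 : Fin s → ℕ} (h1 : m - tm ≤ ∑ i, A1 i) (h2 : m - tm ≤ ∑ i, A2 i)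
    (h3 : m - tm ≤ ∑ i, A3 i) (h4 : m - tm ≤ ∑ i, A4 i) (k1 k2 : ℕ) :
    |Em m s (fun t y => ThetaF m s C A1 A2 k1 t y * ThetaF m s C A3 A4 k2 t y)| ≤
      4 * 16 ^ tm := by
  refine abs_Em_le fun t y => ?_
  rw [abs_mul, show (4 : ℝ) * 16 ^ tm = (2 * 4 ^ tm) * (2 * 4 ^ tm) by
    rw [show (16 : ℝ) = 4 * 4 by norm_num, mul_pow]
    ring]
  exact mul_le_mul (abs_ThetaF_le C hnet htm h1 h2 k1 t y)
    (abs_ThetaF_le C hnet htm h3 h4 k2 t y) (abs_nonneg _) (by positivity)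

end Net

section Counting

variable {s : ℕ}

theorem eq_of_sum_eq {f g : Fin s → ℕ} (i : Fin s) (h : ∀ l, l ≠ i → f l = g l)
    (hs : ∑ l, f l = ∑ l, g l) : f = g := by
  funext l
  by_cases hl : l = i
  · subst hl
    rw [← Finset.add_sum_erase _ f (Finset.mem_univ l),
      ← Finset.add_sum_erase _ g (Finset.mem_univ l),
      Finset.sum_congr rfl fun x hx => h x (Finset.ne_of_mem_erase hx)] at hs
    exact Nat.add_right_cancel hs
  · exact h l hl

/-- Vectors with entries in `{0, …, m}` vanishing on `Z`. -/
def boxOff (m : ℕ) (Z : Finset (Fin s)) : Finset (Fin s → ℕ) :=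
  Fintype.piFinset fun l => if l ∈ Z then {0} else Finset.range (m + 1)

theorem card_boxOff (m : ℕ) (Z : Finset (Fin s)) :
    (boxOff m Z).card = (m + 1) ^ (s - Z.card) := by
  rw [boxOff, Fintype.card_piFinset]
  have h : ∀ l : Fin s, (if l ∈ Z then ({0} : Finset ℕ) else Finset.range (m + 1)).card =
      if l ∈ Z then 1 else m + 1 := by
    intro l
    split_ifs <;> simp
  simp only [h]
  rw [Finset.prod_ite]
  simp only [Finset.prod_const, one_pow, one_mul]
  congr 1
  rw [Finset.filter_not, Finset.filter_mem_eq_inter, Finset.univ_inter,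
    ← Finset.compl_eq_univ_sdiff, Finset.card_compl, Fintype.card_fin]

theorem mem_boxOff {m : ℕ} {Z : Finset (Fin s)} {f : Fin s → ℕ} (hf : ∀ l, f l ≤ m) :
    (fun l => if l ∈ Z then 0 else f l) ∈ boxOff m Z := by
  rw [boxOff, Fintype.mem_piFinset]
  intro l
  have := hf l
  split_ifs
  · simp
  · rw [Finset.mem_range]
    omega

theorem card_paired_le {m : ℕ} (W : Finset ℕ) (σ : Fin s → Fin 3) {i j : Fin s}
    (hi : σ i = 0) (hj : σ j ≠ 0)
    (G : Finset ((Fin s → ℕ) × (Fin s → ℕ) × (Fin s → ℕ) × (Fin s → ℕ)))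
    (hbox : ∀ q ∈ G, ∀ l, q.1 l ≤ m ∧ q.2.1 l ≤ m ∧ q.2.2.1 l ≤ m)
    (hsum : ∀ q ∈ G, ∑ l, q.1 l ∈ W ∧ ∑ l, q.2.1 l ∈ W ∧ ∑ l, q.2.2.1 l ∈ W)
    (hpair : ∀ q ∈ G, ∀ l, (σ l = 0 ∧ q.1 l = q.2.1 l ∧ q.2.2.1 l = q.2.2.2 l) ∨
      (σ l = 1 ∧ q.1 l = q.2.2.1 l ∧ q.2.1 l = q.2.2.2 l) ∨
      (σ l = 2 ∧ q.1 l = q.2.2.2 l ∧ q.2.1 l = q.2.2.1 l)) :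
    G.card ≤ (m + 1) ^ (s - 1) * (m + 1) ^ (s - 2) * W.card ^ 3 := by
  have hij : i ≠ j := by
    rintro rfl
    exact hj hi
  have hcard : (boxOff m {i} ×ˢ boxOff m {i, j} ×ˢ W ×ˢ W ×ˢ W).card =
      (m + 1) ^ (s - 1) * (m + 1) ^ (s - 2) * W.card ^ 3 := by
    simp only [Finset.card_product, card_boxOff, Finset.card_singleton, Finset.card_pair hij]
    ring
  rw [← hcard]
  refine Finset.card_le_card_of_injOn (fun q =>
    (fun l => if l ∈ ({i} : Finset (Fin s)) then 0 else q.1 l,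
      fun l => if l ∈ ({i, j} : Finset (Fin s)) then 0 else
        if σ l = 0 then q.2.2.1 l else q.2.1 l,
      ∑ l, q.1 l, ∑ l, q.2.1 l, ∑ l, q.2.2.1 l)) ?_ ?_
  · intro q hq
    have hb := hbox q hq
    obtain ⟨h1, h2, h3⟩ := hsum q hq
    simp only [Finset.coe_product, Set.mem_prod, Finset.mem_coe]
    refine ⟨mem_boxOff fun l => (hb l).1,
      mem_boxOff (f := fun l => if σ l = 0 then q.2.2.1 l else q.2.1 l) fun l => ?_, h1, h2, h3⟩
    split_ifs
    · exact (hb l).2.2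
    · exact (hb l).2.1
  · rintro ⟨A1, A2, A3, A4⟩ hA ⟨B1, B2, B3, B4⟩ hB hAB
    have pA := hpair _ hA
    have pB := hpair _ hB
    simp only [Prod.mk.injEq] at hAB pA pB
    obtain ⟨hu, hv, hs1, hs2, hs3⟩ := hAB
    have e1 : A1 = B1 := by
      refine eq_of_sum_eq i (fun l hl => ?_) hs1
      simpa [hl] using congrFun hu l
    subst e1
    have e2 : A2 = B2 := by
      refine eq_of_sum_eq j (fun l hl => ?_) hs2
      have a := pA l
      have b := pB l
      by_cases h0 : σ l = 0
      · simp only [h0, true_and, show ¬ (0 : Fin 3) = 1 by decide,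
          show ¬ (0 : Fin 3) = 2 by decide, false_and, or_false] at a b
        rw [← a.1, b.1]
      · have hli : l ≠ i := by
          rintro rfl
          exact h0 hi
        simpa [hl, hli, h0] using congrFun hv l
    subst e2
    have e3 : A3 = B3 := by
      refine eq_of_sum_eq i (fun l hl => ?_) hs3
      have a := pA l
      have b := pB l
      by_cases h0 : σ l = 0
      · have hlj : l ≠ j := by
          rintro rfl
          exact hj h0
        simpa [hl, hlj, h0] using congrFun hv l
      · grind
    subst e3
    have e4 : A4 = B4 := by
      funext l
      have a := pA l
      have b := pB l
      grind
    rw [e4]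

theorem card_near_le {m w : ℕ} (W : Finset ℕ) (i : Fin s)
    (G : Finset ((Fin s → ℕ) × (Fin s → ℕ)))
    (hbox : ∀ q ∈ G, ∀ l, q.1 l ≤ m) (hsum : ∀ q ∈ G, ∑ l, q.1 l ∈ W)
    (hnear : ∀ q ∈ G, ∀ l, q.1 l ≤ q.2 l + w ∧ q.2 l ≤ q.1 l + w) :
    G.card ≤ (m + 1) ^ (s - 1) * W.card * (2 * w + 1) ^ s := by
  have hcard : (boxOff m {i} ×ˢ W ×ˢ boxOff (2 * w) (∅ : Finset (Fin s))).card =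
      (m + 1) ^ (s - 1) * W.card * (2 * w + 1) ^ s := by
    simp only [Finset.card_product, card_boxOff, Finset.card_singleton, Finset.card_empty,
      Nat.sub_zero]
    ring
  rw [← hcard]
  refine Finset.card_le_card_of_injOn (fun q =>
    (fun l => if l ∈ ({i} : Finset (Fin s)) then 0 else q.1 l, ∑ l, q.1 l,
      fun l => if l ∈ (∅ : Finset (Fin s)) then 0 else q.2 l + w - q.1 l)) ?_ ?_
  · intro q hq
    simp only [Finset.coe_product, Set.mem_prod, Finset.mem_coe]
    refine ⟨mem_boxOff (hbox q hq), hsum q hq,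
      mem_boxOff (f := fun l => q.2 l + w - q.1 l) fun l => ?_⟩
    have := hnear q hq l
    omega
  · rintro ⟨A, A'⟩ hA ⟨B, B'⟩ hB hAB
    have pA := hnear _ hA
    have pB := hnear _ hB
    simp only [Prod.mk.injEq] at hAB pA pB
    obtain ⟨hu, hs1, hv⟩ := hAB
    have e1 : A = B := by
      refine eq_of_sum_eq i (fun l hl => ?_) hs1
      simpa [hl] using congrFun hu l
    subst e1
    have e2 : A' = B' := by
      funext l
      have h1 := congrFun hv l
      have h2 := pA l
      have h3 := pB l
      simp only [Finset.notMem_empty, if_false] at h1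
      omega
    rw [e2]

theorem card_quadruples_le {m w : ℕ} (W : Finset ℕ) (i₀ : Fin s)
    (G : Finset ((Fin s → ℕ) × (Fin s → ℕ) × (Fin s → ℕ) × (Fin s → ℕ)))
    (hbox : ∀ q ∈ G, ∀ l, q.1 l ≤ m ∧ q.2.1 l ≤ m ∧ q.2.2.1 l ≤ m)
    (hsum : ∀ q ∈ G, ∑ l, q.1 l ∈ W ∧ ∑ l, q.2.1 l ∈ W ∧ ∑ l, q.2.2.1 l ∈ W)
    (hpair : ∀ q ∈ G, ∀ l, (q.1 l = q.2.1 l ∧ q.2.2.1 l = q.2.2.2 l) ∨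
      (q.1 l = q.2.2.1 l ∧ q.2.1 l = q.2.2.2 l) ∨ (q.1 l = q.2.2.2 l ∧ q.2.1 l = q.2.2.1 l))
    (hmeet : ∀ q ∈ G, ∃ i, q.1 i = q.2.1 i)
    (hnear : ∀ q ∈ G, q.1 = q.2.1 → ∀ l, q.1 l ≤ q.2.2.1 l + w ∧ q.2.2.1 l ≤ q.1 l + w) :
    G.card ≤ 3 ^ s * s ^ 2 * ((m + 1) ^ (s - 1) * (m + 1) ^ (s - 2) * W.card ^ 3) +
      (m + 1) ^ (s - 1) * W.card * (2 * w + 1) ^ s := by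
  rw [← Finset.card_filter_add_card_filter_not (s := G) (fun q => q.1 ≠ q.2.1)]
  refine add_le_add ?_ ?_
  · let P : (Fin s → Fin 3) × Fin s × Fin s →
        ((Fin s → ℕ) × (Fin s → ℕ) × (Fin s → ℕ) × (Fin s → ℕ)) → Prop := fun c q =>
      c.1 c.2.1 = 0 ∧ c.1 c.2.2 ≠ 0 ∧
        ∀ l, (c.1 l = 0 ∧ q.1 l = q.2.1 l ∧ q.2.2.1 l = q.2.2.2 l) ∨
        (c.1 l = 1 ∧ q.1 l = q.2.2.1 l ∧ q.2.1 l = q.2.2.2 l) ∨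
        (c.1 l = 2 ∧ q.1 l = q.2.2.2 l ∧ q.2.1 l = q.2.2.1 l)
    have hcover : G.filter (fun q => q.1 ≠ q.2.1) ⊆
        Finset.univ.biUnion fun c => G.filter (P c) := by
      intro q hq
      rw [Finset.mem_filter] at hq
      obtain ⟨hqG, hne⟩ := hq
      obtain ⟨i, hi⟩ := hmeet q hqG
      obtain ⟨j, hj⟩ := Function.ne_iff.mp hne
      have hσ : ∀ l, ∃ c : Fin 3, (c = 0 ↔ q.1 l = q.2.1 l) ∧
          ((c = 0 ∧ q.1 l = q.2.1 l ∧ q.2.2.1 l = q.2.2.2 l) ∨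
          (c = 1 ∧ q.1 l = q.2.2.1 l ∧ q.2.1 l = q.2.2.2 l) ∨
          (c = 2 ∧ q.1 l = q.2.2.2 l ∧ q.2.1 l = q.2.2.1 l)) := by
        intro l
        have hp := hpair q hqG l
        by_cases h0 : q.1 l = q.2.1 l
        · exact ⟨0, by simp [h0], Or.inl ⟨rfl, h0, by omega⟩⟩
        · rcases hp with hp | hp | hp
          · exact absurd hp.1 h0
          · exact ⟨1, by simp [h0], Or.inr (Or.inl ⟨rfl, hp⟩)⟩
          · exact ⟨2, by simp [h0], Or.inr (Or.inr ⟨rfl, hp⟩)⟩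
      choose σ hσ using hσ
      rw [Finset.mem_biUnion]
      refine ⟨(σ, i, j), Finset.mem_univ _, Finset.mem_filter.mpr ⟨hqG, ?_⟩⟩
      exact ⟨(hσ i).1.mpr hi, fun h => hj ((hσ j).1.mp h), fun l => (hσ l).2⟩
    refine (Finset.card_le_card hcover).trans ?_
    have hc : (Finset.univ : Finset ((Fin s → Fin 3) × Fin s × Fin s)).card = 3 ^ s * s ^ 2 := by
      simp [sq]
    rw [← hc]
    refine Finset.card_biUnion_le_card_mul _ _ _ fun c _ => ?_
    by_cases hc : c.1 c.2.1 = 0 ∧ c.1 c.2.2 ≠ 0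
    · refine card_paired_le W c.1 hc.1 hc.2 _ ?_ ?_ ?_
      · exact fun q hq => hbox q (Finset.mem_filter.mp hq).1
      · exact fun q hq => hsum q (Finset.mem_filter.mp hq).1
      · exact fun q hq => (Finset.mem_filter.mp hq).2.2.2
    · rw [Finset.filter_false_of_mem fun q _ hq => hc ⟨hq.1, hq.2.1⟩]
      simp
  · have hinj : Set.InjOn (fun q : (Fin s → ℕ) × (Fin s → ℕ) × (Fin s → ℕ) × (Fin s → ℕ) =>
        (q.1, q.2.2.1)) (G.filter fun q => ¬ q.1 ≠ q.2.1) := by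
      rintro ⟨A1, A2, A3, A4⟩ hA ⟨B1, B2, B3, B4⟩ hB hAB
      rw [Finset.mem_coe, Finset.mem_filter] at hA hB
      have pA := hpair _ hA.1
      have pB := hpair _ hB.1
      have dA := not_not.mp hA.2
      have dB := not_not.mp hB.2
      simp only [Prod.mk.injEq] at hAB pA pB dA dB
      obtain ⟨rfl, rfl⟩ := hAB
      subst dA dB
      have : A4 = B4 := by
        funext l
        have := pA l
        have := pB l
        omega
      rw [this]
    rw [← Finset.card_image_of_injOn hinj]
    refine card_near_le W i₀ _ ?_ ?_ ?_
    all_goals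
      intro p hp
      obtain ⟨q, hq, rfl⟩ := Finset.mem_image.mp hp
      rw [Finset.mem_filter, not_not] at hq
    · exact fun l => (hbox q hq.1 l).1
    · exact (hsum q hq.1).1
    · exact hnear q hq.1 hq.2

end Counting

section SecondMoment

variable {m s tm : ℕ}

/-- The range of `a₀(A)` over the index sets. -/
def sumWindow (m tm : ℕ) : Finset ℕ := Finset.Icc (m - tm) (m + ⌊V0 m⌋₊)

theorem card_sumWindow (htm : tm ≤ m) : (sumWindow m tm).card = ⌊V0 m⌋₊ + tm + 1 := by
  rw [sumWindow, Nat.card_Icc]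
  omega

theorem of_mem_IndexSet (htm : tm ≤ m) {k : ℕ} {A : Fin s → ℕ} (hA : A ∈ IndexSet m s tm k) :
    (∀ i, A i ≤ m) ∧ Finset.univ.sup A = k ∧ ∑ i, A i ∈ sumWindow m tm := by
  rw [IndexSet, Finset.mem_filter, Fintype.mem_piFinset] at hA
  obtain ⟨h1, h2, h3, h4⟩ := hA
  unfold a0F at h3 h4
  refine ⟨fun i => Nat.lt_succ_iff.mp (Finset.mem_range.mp (h1 i)), h2, ?_⟩
  rw [sumWindow, Finset.mem_Icc]
  constructor
  · rw [← Nat.cast_sub htm] at h3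
    exact_mod_cast h3.le
  · rw [← Nat.sub_le_iff_le_add']
    refine Nat.le_floor ?_
    rcases le_total m (∑ i, A i) with h | h
    · rw [Nat.cast_sub h]
      linarith
    · rw [Nat.sub_eq_zero_of_le h, Nat.cast_zero]
      have : 0 ≤ Real.logb 2 (m : ℝ) := by
        rcases Nat.eq_zero_or_pos m with hm | hm
        · simp [hm]
        · exact Real.logb_nonneg one_lt_two (by exact_mod_cast hm)
      unfold V0
      linarith

variable (C : Fin s → Matrix (Fin m) (Fin m) (ZMod 2))

theorem sum_EmCond_DDk_sq_sub (t y : Fin s → Fin m → Fin 2) :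
    (∑ k ∈ Finset.Icc 1 m,
      (EmCond m s (k - 1) (fun t' y' => DDk m s tm C k t' y' ^ 2) t y -
        Em m s fun t' y' => DDk m s tm C k t' y' ^ 2)) =
    ∑ p ∈ (Finset.Icc 1 m).sigma fun k => IndexSet m s tm k ×ˢ IndexSet m s tm k,
      ThetaF m s C p.2.1 p.2.2 p.1 t y := by
  rw [Finset.sum_sigma]
  refine Finset.sum_congr rfl fun k _ => ?_
  simp only [DDk, sq, Finset.sum_mul_sum, ← Finset.sum_product']
  rw [EmCond_sum, Em_sum, ← Finset.sum_sub_distrib]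
  rfl

theorem dist_le_of_sum_inf {A B : Fin s → ℕ} (hA : ∑ i, A i ∈ sumWindow m tm)
    (hAB : m - tm < ∑ i, (A ⊓ B) i) (l : Fin s) : A l ≤ B l + (⌊V0 m⌋₊ + tm + 1) := by
  have h1 : A l - (A ⊓ B) l ≤ ∑ i, (A i - (A ⊓ B) i) :=
    Finset.single_le_sum (f := fun i => A i - (A ⊓ B) i) (fun _ _ => Nat.zero_le _)
      (Finset.mem_univ l)
  have hsub : ∑ i, (A i - (A ⊓ B) i) = ∑ i, A i - ∑ i, (A ⊓ B) i :=
    Finset.sum_tsub_distrib _ fun i _ => (inf_le_left : A ⊓ B ≤ A) i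
  rw [hsub] at h1
  rw [sumWindow, Finset.mem_Icc] at hA
  have h2 : (A ⊓ B) l ≤ B l := (inf_le_right : A ⊓ B ≤ B) l
  omega

theorem Em_sq_sum_EmCond_DDk_le (hs : 0 < s) (htm : tm ≤ m)
    (hnet : IsNet tm m s (fun n : Fin (2 ^ m) => netPoint m s C (n : ℕ))) :
    Em m s (fun t y =>
        (∑ k ∈ Finset.Icc 1 m,
          (EmCond m s (k - 1) (fun t' y' => DDk m s tm C k t' y' ^ 2) t y -
            Em m s fun t' y' => DDk m s tm C k t' y' ^ 2)) ^ 2) ≤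
      ((3 ^ s * s ^ 2 * ((m + 1) ^ (s - 1) * (m + 1) ^ (s - 2) * (⌊V0 m⌋₊ + tm + 1) ^ 3) +
        (m + 1) ^ (s - 1) * (⌊V0 m⌋₊ + tm + 1) * (2 * (⌊V0 m⌋₊ + tm + 1) + 1) ^ s : ℕ) : ℝ) *
        (4 * 16 ^ tm) := by
  simp only [sum_EmCond_DDk_sq_sub]
  set S := (Finset.Icc 1 m).sigma fun k => IndexSet m s tm k ×ˢ IndexSet m s tm k with hS
  have hmem : ∀ p ∈ S, (1 ≤ p.1 ∧ p.1 ≤ m) ∧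
      ((∀ i, p.2.1 i ≤ m) ∧ Finset.univ.sup p.2.1 = p.1 ∧ ∑ i, p.2.1 i ∈ sumWindow m tm) ∧
      ((∀ i, p.2.2 i ≤ m) ∧ Finset.univ.sup p.2.2 = p.1 ∧ ∑ i, p.2.2 i ∈ sumWindow m tm) := by
    intro p hp
    rw [hS, Finset.mem_sigma, Finset.mem_product, Finset.mem_Icc] at hp
    exact ⟨hp.1, of_mem_IndexSet htm hp.2.1, of_mem_IndexSet htm hp.2.2⟩
  have hwin : ∀ n ∈ sumWindow m tm, m - tm ≤ n := fun n hn => (Finset.mem_Icc.mp hn).1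
  let F : (Σ _ : ℕ, (Fin s → ℕ) × (Fin s → ℕ)) × (Σ _ : ℕ, (Fin s → ℕ) × (Fin s → ℕ)) → ℝ :=
    fun r => Em m s fun t y =>
      ThetaF m s C r.1.2.1 r.1.2.2 r.1.1 t y * ThetaF m s C r.2.2.1 r.2.2.2 r.2.1 t y
  have hF : Em m s (fun t y => (∑ p ∈ S, ThetaF m s C p.2.1 p.2.2 p.1 t y) ^ 2) =
      ∑ r ∈ S ×ˢ S, F r := by
    simp only [sq, Finset.sum_mul_sum, ← Finset.sum_product']
    rw [Em_sum]
  rw [hF, ← Finset.sum_filter_ne_zero]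
  set G := (S ×ˢ S).filter fun r => F r ≠ 0 with hG
  have hGmem : ∀ r ∈ G, r.1 ∈ S ∧ r.2 ∈ S ∧ F r ≠ 0 := by
    intro r hr
    rw [hG, Finset.mem_filter, Finset.mem_product] at hr
    exact ⟨hr.1.1, hr.1.2, hr.2⟩
  have hle : ∀ r ∈ G, F r ≤ 4 * 16 ^ tm := by
    intro r hr
    obtain ⟨h1, h2, -⟩ := hGmem r hr
    have m1 := hmem _ h1
    have m2 := hmem _ h2
    exact (le_abs_self _).trans (abs_Em_ThetaF_mul_le C hnet htm (hwin _ m1.2.1.2.2)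
      (hwin _ m1.2.2.2.2) (hwin _ m2.2.1.2.2) (hwin _ m2.2.2.2.2) _ _)
  have hsum := Finset.sum_le_card_nsmul G F _ hle
  rw [nsmul_eq_mul] at hsum
  refine hsum.trans (mul_le_mul_of_nonneg_right ?_ (by positivity))
  rw [Nat.cast_le]
  have hinj : Set.InjOn (fun r : (Σ _ : ℕ, (Fin s → ℕ) × (Fin s → ℕ)) ×
      (Σ _ : ℕ, (Fin s → ℕ) × (Fin s → ℕ)) => (r.1.2.1, r.1.2.2, r.2.2.1, r.2.2.2)) G := by
    rintro ⟨⟨k1, A1, A2⟩, ⟨k2, A3, A4⟩⟩ hA ⟨⟨l1, B1, B2⟩, ⟨l2, B3, B4⟩⟩ hB hAB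
    obtain ⟨a1, a2, -⟩ := hGmem _ hA
    obtain ⟨b1, b2, -⟩ := hGmem _ hB
    have e1 := (hmem _ a1).2.1.2.1
    have e2 := (hmem _ a2).2.1.2.1
    have f1 := (hmem _ b1).2.1.2.1
    have f2 := (hmem _ b2).2.1.2.1
    simp only [Prod.mk.injEq] at hAB e1 e2 f1 f2
    obtain ⟨rfl, rfl, rfl, rfl⟩ := hAB
    rw [← e1, ← e2, ← f1, ← f2]
  rw [← Finset.card_image_of_injOn hinj]
  have hpair : ∀ r ∈ G, ∀ l, (r.1.2.1 l = r.1.2.2 l ∧ r.2.2.1 l = r.2.2.2 l) ∨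
      (r.1.2.1 l = r.2.2.1 l ∧ r.1.2.2 l = r.2.2.2 l) ∨
      (r.1.2.1 l = r.2.2.2 l ∧ r.1.2.2 l = r.2.2.1 l) := by
    intro r hr
    obtain ⟨h1, h2, h3⟩ := hGmem r hr
    have m1 := hmem _ h1
    have m2 := hmem _ h2
    exact pairing_of_Em_ne_zero C m1.2.1.1 m1.2.2.1 m2.2.1.1 m2.2.2.1 h3
  rw [← card_sumWindow htm]
  refine card_quadruples_le (sumWindow m tm) ⟨0, hs⟩ _ ?_ ?_ ?_ ?_ ?_
  all_goals
    intro q hq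
    obtain ⟨r, hr, rfl⟩ := Finset.mem_image.mp hq
    obtain ⟨h1, h2, h3⟩ := hGmem r hr
    have m1 := hmem _ h1
    have m2 := hmem _ h2
  · exact fun l => ⟨m1.2.1.1 l, m1.2.2.1 l, m2.2.1.1 l⟩
  · exact ⟨m1.2.1.2.2, m1.2.2.2.2, m2.2.1.2.2⟩
  · exact hpair r hr
  · obtain ⟨i, -, hi⟩ := Finset.exists_mem_eq_sup Finset.univ
      ⟨(⟨0, hs⟩ : Fin s), Finset.mem_univ _⟩ r.1.2.1
    rw [m1.2.1.2.1] at hi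
    have hΘ : ∃ t y, ThetaF m s C r.1.2.1 r.1.2.2 r.1.1 t y ≠ 0 := by
      by_contra hcon
      push Not at hcon
      apply h3
      simp only [F, hcon, zero_mul, Em_const]
    obtain ⟨t, y, hΘ⟩ := hΘ
    have := (eq_iff_eq_of_ThetaF_ne_zero C m1.1.1 m1.1.2 hΘ i).mp hi.symm
    exact ⟨i, hi.symm.trans this.symm⟩
  · intro h12
    dsimp only at h12 ⊢
    have h34 : r.2.2.1 = r.2.2.2 := by
      funext l
      have := hpair r hr l
      have := congrFun h12 l
      omega
    have hne : Em m s (fun t y => ThetaF m s C r.1.2.1 r.1.2.1 r.1.1 t y *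
        ThetaF m s C r.2.2.1 r.2.2.1 r.2.1 t y) ≠ 0 := by
      simp only [F, ← h12, ← h34] at h3
      exact h3
    have hlt := lt_sum_of_dualBelow_nonempty C hnet htm
      (dualBelow_inf_nonempty_of_Em_ne_zero C hne) hs
    intro l
    rw [card_sumWindow htm]
    refine ⟨dist_le_of_sum_inf m1.2.1.2.2 hlt l, dist_le_of_sum_inf m2.2.1.2.2 ?_ l⟩
    rwa [inf_comm]

end SecondMoment

section Asymptotics

theorem window_width_le {δ : ℝ} (hδ : 0 < δ) {m tm : ℕ} (hm : 1 ≤ m)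
    (htm : (tm : ℝ) ≤ Real.logb 2 m / 10) :
    ((⌊V0 m⌋₊ + tm + 1 : ℕ) : ℝ) ≤ (11 / (Real.log 2 * δ) + 1) * (m : ℝ) ^ δ := by
  have hm' : (1 : ℝ) ≤ m := by exact_mod_cast hm
  have hl2 : 0 < Real.log 2 := Real.log_pos one_lt_two
  have hlogb : 0 ≤ Real.logb 2 (m : ℝ) := Real.logb_nonneg one_lt_two hm'
  have hV : ((⌊V0 m⌋₊ : ℕ) : ℝ) ≤ 10 * Real.logb 2 m := by
    refine Nat.floor_le ?_
    unfold V0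
    positivity
  have h1 : Real.logb 2 (m : ℝ) ≤ (m : ℝ) ^ δ / (Real.log 2 * δ) := by
    have := Real.log_le_rpow_div (by linarith : (0 : ℝ) ≤ m) hδ
    rw [Real.logb, div_le_div_iff₀ hl2 (by positivity)]
    rw [le_div_iff₀ hδ] at this
    nlinarith
  have h2 : (1 : ℝ) ≤ (m : ℝ) ^ δ := Real.one_le_rpow hm' hδ.le
  push_cast
  have h3 : (11 / (Real.log 2 * δ) + 1) * (m : ℝ) ^ δ =
      11 * ((m : ℝ) ^ δ / (Real.log 2 * δ)) + (m : ℝ) ^ δ := by ring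
  rw [h3]
  linarith

theorem count_le {s : ℕ} (hs : 2 ≤ s) {m w : ℕ} (hm : 1 ≤ m) (hw : 1 ≤ w) :
    3 ^ s * s ^ 2 * ((m + 1) ^ (s - 1) * (m + 1) ^ (s - 2) * w ^ 3) +
      (m + 1) ^ (s - 1) * w * (2 * w + 1) ^ s ≤
    (3 ^ s * s ^ 2 + 3 ^ s) * 2 ^ (2 * s - 3) * (m ^ (2 * s - 3) * w ^ (s + 3)) := by
  have h1 : (m + 1) ^ (s - 1) * (m + 1) ^ (s - 2) ≤ 2 ^ (2 * s - 3) * m ^ (2 * s - 3) := by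
    rw [← pow_add, ← mul_pow, show s - 1 + (s - 2) = 2 * s - 3 by omega]
    exact Nat.pow_le_pow_left (by omega) _
  have h2 : (m + 1) ^ (s - 1) ≤ 2 ^ (2 * s - 3) * m ^ (2 * s - 3) := by
    refine le_trans ?_ h1
    exact Nat.le_mul_of_pos_right _ (by positivity)
  have h3 : w ^ 3 ≤ w ^ (s + 3) := Nat.pow_le_pow_right hw (by omega)
  have h4 : w * (2 * w + 1) ^ s ≤ 3 ^ s * w ^ (s + 3) := by
    calc w * (2 * w + 1) ^ s ≤ w * (3 * w) ^ s :=
          Nat.mul_le_mul_left _ (Nat.pow_le_pow_left (by omega) _)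
      _ = 3 ^ s * w ^ (s + 1) := by ring
      _ ≤ 3 ^ s * w ^ (s + 3) := Nat.mul_le_mul_left _ (Nat.pow_le_pow_right hw (by omega))
  calc _ ≤ 3 ^ s * s ^ 2 * (2 ^ (2 * s - 3) * m ^ (2 * s - 3) * w ^ (s + 3)) +
        2 ^ (2 * s - 3) * m ^ (2 * s - 3) * (3 ^ s * w ^ (s + 3)) := by
        refine add_le_add (Nat.mul_le_mul_left _ (Nat.mul_le_mul h1 h3)) ?_
        rw [mul_assoc]
        exact Nat.mul_le_mul h2 h4
    _ = _ := by ring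

theorem sixteen_pow_le {m tm : ℕ} (hm : 1 ≤ m) (htm : (tm : ℝ) ≤ Real.logb 2 m / 10) :
    (16 : ℝ) ^ tm ≤ (m : ℝ) ^ (2 / 5 : ℝ) := by
  have hm' : (0 : ℝ) < m := by exact_mod_cast hm
  calc (16 : ℝ) ^ tm = (2 : ℝ) ^ (4 * (tm : ℝ)) := by
        rw [Real.rpow_mul two_pos.le, Real.rpow_natCast]
        norm_num
    _ ≤ (2 : ℝ) ^ (Real.logb 2 m * (2 / 5)) :=
        Real.rpow_le_rpow_of_exponent_le one_le_two (by linarith)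
    _ = (m : ℝ) ^ (2 / 5 : ℝ) := by
        rw [Real.rpow_mul two_pos.le, Real.rpow_logb two_pos (by norm_num) hm']

theorem le_of_le_logb {m tm : ℕ} (hm : 1 ≤ m) (htm : (tm : ℝ) ≤ Real.logb 2 m / 10) :
    tm ≤ m := by
  have hm' : (0 : ℝ) < m := by exact_mod_cast hm
  have h : Real.logb 2 (m : ℝ) ≤ m := by
    rw [Real.logb_le_iff_le_rpow one_lt_two hm', Real.rpow_natCast]
    exact_mod_cast Nat.lt_two_pow_self.le
  have : (tm : ℝ) ≤ m := by linarith
  exact_mod_cast this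

end Asymptotics

/-- Corollary 2: the Levi conditional expectation satisfies
`E^{(m)}_{Y,T}((∑_{k=1}^m (E^{(m)}_{Y,T}(𝔇_k² | F_{k-1}) - E^{(m)}_{Y,T}(𝔇_k²)))²)
≪ m^{2(s-1)-1/5}`, with the implied constant depending only on `s`. -/
theorem statement15 (s : ℕ) (hs : 2 ≤ s) :
    ∃ c : ℝ, 0 < c ∧ ∀ (m tm : ℕ), 1 ≤ m →
      ∀ C : Fin s → Matrix (Fin m) (Fin m) (ZMod 2),
        IsNet tm m s (fun n : Fin (2 ^ m) => netPoint m s C (n : ℕ)) →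
        (tm : ℝ) ≤ Real.logb 2 m / 10 →
        Em m s (fun t y =>
            (∑ k ∈ Finset.Icc 1 m,
                (EmCond m s (k - 1) (fun t' y' => DDk m s tm C k t' y' ^ 2) t y -
                  Em m s fun t' y' => DDk m s tm C k t' y' ^ 2)) ^ 2) ≤
          c * (m : ℝ) ^ (2 * ((s : ℝ) - 1) - 1 / 5) := by
  set δ : ℝ := 2 / (5 * ((s : ℝ) + 3)) with hδdef
  have hδ : 0 < δ := by positivity
  set a : ℝ := 11 / (Real.log 2 * δ) + 1 with ha
  have ha0 : 0 < a := by
    have : 0 < Real.log 2 := Real.log_pos one_lt_two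
    positivity
  refine ⟨((3 ^ s * s ^ 2 + 3 ^ s) * 2 ^ (2 * s - 3)) * a ^ (s + 3) * 4, by positivity, ?_⟩
  intro m tm hm C hnet htm
  have hm' : (0 : ℝ) < m := by exact_mod_cast hm
  have htmm := le_of_le_logb hm htm
  refine (Em_sq_sum_EmCond_DDk_le C (by omega) htmm hnet).trans ?_
  have hw := window_width_le hδ hm htm
  have h16 := sixteen_pow_le hm htm
  have hcount := count_le hs hm (Nat.le_add_left 1 (⌊V0 m⌋₊ + tm))
  generalize ⌊V0 m⌋₊ + tm + 1 = w at hw hcount ⊢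
  have hcount' := (Nat.cast_le (α := ℝ)).mpr hcount
  refine (mul_le_mul_of_nonneg_right hcount' (by positivity)).trans ?_
  have hwpow : (w : ℝ) ^ (s + 3) ≤ a ^ (s + 3) * (m : ℝ) ^ (2 / 5 : ℝ) := by
    calc (w : ℝ) ^ (s + 3) ≤ (a * (m : ℝ) ^ δ) ^ (s + 3) :=
          pow_le_pow_left₀ (Nat.cast_nonneg _) hw _
      _ = a ^ (s + 3) * (m : ℝ) ^ (2 / 5 : ℝ) := by
          rw [mul_pow, ← Real.rpow_natCast ((m : ℝ) ^ δ), ← Real.rpow_mul hm'.le]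
          congr 2
          rw [hδdef]
          push_cast
          field_simp
  have hexp : (m : ℝ) ^ (2 * ((s : ℝ) - 1) - 1 / 5) =
      (m : ℝ) ^ (2 * s - 3) * (m : ℝ) ^ (2 / 5 : ℝ) * (m : ℝ) ^ (2 / 5 : ℝ) := by
    rw [← Real.rpow_natCast (m : ℝ) (2 * s - 3), ← Real.rpow_add hm', ← Real.rpow_add hm',
      Nat.cast_sub (by omega)]
    congr 1
    push_cast
    ring
  rw [hexp]
  push_cast
  calc ((3 : ℝ) ^ s * s ^ 2 + 3 ^ s) * 2 ^ (2 * s - 3) *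
        ((m : ℝ) ^ (2 * s - 3) * (w : ℝ) ^ (s + 3)) * (4 * 16 ^ tm)
      ≤ ((3 : ℝ) ^ s * s ^ 2 + 3 ^ s) * 2 ^ (2 * s - 3) *
        ((m : ℝ) ^ (2 * s - 3) * (a ^ (s + 3) * (m : ℝ) ^ (2 / 5 : ℝ))) *
          (4 * (m : ℝ) ^ (2 / 5 : ℝ)) := by gcongr
    _ = _ := by ring
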